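/- Let F(τ) = η(2τ)²·η(26τ)²/(η(τ)²·η(13τ)²) for τ with Im τ > 0. For every a, b, c, d ∈ ℤ with ad − bc = 1 and c ≡ 0 (mod 26), there exists w ∈ ℂ with w¹² = 1 such that F((aτ+b)/(cτ+d)) = w·F(τ) for all τ ∈ ℂ with Im τ > 0. -/

import Mathlib

/-- The Dedekind eta function `η(τ) = e^{πiτ/12} ∏_{n≥1} (1 - e^{2πinτ})`. -/
noncomputable def dedekindEta (τ : ℂ) : ℂ :=
  Complex.exp (Real.pi * Complex.I * τ / 12) *
    ∏' n : ℕ, (1 - Complex.exp (2 * Real.pi * Complex.I * (n + 1) * τ))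

/-- `F(τ) = η(2τ)²η(26τ)² / (η(τ)²η(13τ)²)`. -/
noncomputable def F26 (τ : ℂ) : ℂ :=
  dedekindEta (2 * τ) ^ 2 * dedekindEta (26 * τ) ^ 2 /
    (dedekindEta τ ^ 2 * dedekindEta (13 * τ) ^ 2)

open UpperHalfPlane (upperHalfPlaneSet)

theorem dedekindEta_eq_modularForm_eta : dedekindEta = ModularForm.eta := by
  funext τ
  simp only [dedekindEta, ModularForm.eta, ModularForm.eta_q_eq_cexp, Function.Periodic.qParam]
  congr 2
  push_cast
  ring

theorem dedekindEta_ne_zero {τ : ℂ} (hτ : 0 < τ.im) : dedekindEta τ ≠ 0 := by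
  rw [dedekindEta_eq_modularForm_eta]
  exact ModularForm.eta_ne_zero hτ

theorem continuousAt_dedekindEta {τ : ℂ} (hτ : 0 < τ.im) : ContinuousAt dedekindEta τ := by
  rw [dedekindEta_eq_modularForm_eta]
  exact (ModularForm.differentiableAt_eta_of_mem_upperHalfPlaneSet hτ).continuousAt

/-- The element of `SL₂(ℤ)` with entries `a, b, c, d`. -/
def specialLinearGroupMk (a b c d : ℤ) (h : a * d - b * c = 1) :
    Matrix.SpecialLinearGroup (Fin 2) ℤ :=
  ⟨!![a, b; c, d], by rw [Matrix.det_fin_two_of, h]⟩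

theorem coe_specialLinearGroupMk_smul {a b c d : ℤ} (h : a * d - b * c = 1)
    (z : UpperHalfPlane) :
    ((specialLinearGroupMk a b c d h • z : UpperHalfPlane) : ℂ) = (a * z + b) / (c * z + d) := by
  rw [UpperHalfPlane.coe_specialLinearGroup_apply]
  simp [specialLinearGroupMk]

theorem im_moebius_pos {a b c d : ℤ} (h : a * d - b * c = 1) {τ : ℂ} (hτ : 0 < τ.im) :
    0 < (((a : ℂ) * τ + b) / (c * τ + d)).im := by
  rw [← coe_specialLinearGroupMk_smul h ⟨τ, hτ⟩]
  exact UpperHalfPlane.im_pos _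

theorem moebius_denom_ne_zero {a b c d : ℤ} (h : a * d - b * c = 1) {τ : ℂ} (hτ : 0 < τ.im) :
    (c : ℂ) * τ + d ≠ 0 := by
  intro h0
  simpa [h0] using im_moebius_pos h hτ

theorem dedekindEta_moebius_pow {a b c d : ℤ} (h : a * d - b * c = 1) {τ : ℂ} (hτ : 0 < τ.im) :
    dedekindEta ((a * τ + b) / (c * τ + d)) ^ 24 = (c * τ + d) ^ 12 * dedekindEta τ ^ 24 := by
  have hslash := congrFun (SlashInvariantForm.slash_action_generators_SL2Z
    ModularForm.discriminant_S_invariant ModularForm.discriminant_T_invariant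
    (specialLinearGroupMk a b c d h)) ⟨τ, hτ⟩
  rw [ModularForm.SL_slash_apply, ModularForm.discriminant, ModularForm.discriminant,
    coe_specialLinearGroupMk_smul h, ← dedekindEta_eq_modularForm_eta] at hslash
  have hne := moebius_denom_ne_zero h hτ
  rw [ModularGroup.denom_apply] at hslash
  simp only [specialLinearGroupMk, Matrix.of_apply, Matrix.cons_val, zpow_neg, zpow_ofNat] at hslash
  rw [← hslash, mul_left_comm, mul_inv_cancel₀ (pow_ne_zero _ hne), mul_one]

theorem dedekindEta_mul_moebius_pow {a b c d N : ℤ} (h : a * d - b * c = 1) (hN : 0 < N)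
    (hNc : N ∣ c) {τ : ℂ} (hτ : 0 < τ.im) :
    dedekindEta (N * ((a * τ + b) / (c * τ + d))) ^ 24 =
      (c * τ + d) ^ 12 * dedekindEta (N * τ) ^ 24 := by
  obtain ⟨k, rfl⟩ := hNc
  have hdet : a * d - (b * N) * k = 1 := by rw [← h]; ring
  have him : 0 < ((N : ℂ) * τ).im := by
    simpa using mul_pos (Int.cast_pos.mpr hN) hτ
  convert dedekindEta_moebius_pow hdet him using 2
  · congr 1
    push_cast
    ring
  · push_cast
    ring

theorem im_ofNat_mul_pos {n : ℕ} [n.AtLeastTwo] {τ : ℂ} (hτ : 0 < τ.im) :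
    0 < ((OfNat.ofNat n : ℂ) * τ).im := by
  simpa using mul_pos (Nat.ofNat_pos (α := ℝ) (n := n)) hτ

theorem F26_ne_zero {τ : ℂ} (hτ : 0 < τ.im) : F26 τ ≠ 0 := by
  simp [F26, dedekindEta_ne_zero hτ, dedekindEta_ne_zero (im_ofNat_mul_pos hτ)]

theorem continuousAt_F26 {τ : ℂ} (hτ : 0 < τ.im) : ContinuousAt F26 τ := by
  have hmul (n : ℕ) [n.AtLeastTwo] :
      ContinuousAt (fun z : ℂ ↦ dedekindEta (OfNat.ofNat n * z)) τ :=
    (continuousAt_dedekindEta (im_ofNat_mul_pos hτ)).comp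
      (f := fun z : ℂ ↦ OfNat.ofNat n * z) (by fun_prop)
  refine (((hmul 2).pow 2).mul ((hmul 26).pow 2)).div
    (((continuousAt_dedekindEta hτ).pow 2).mul ((hmul 13).pow 2)) ?_
  simp [dedekindEta_ne_zero hτ, dedekindEta_ne_zero (im_ofNat_mul_pos hτ)]

theorem F26_moebius_pow {a b c d : ℤ} (h : a * d - b * c = 1) (hc : (26 : ℤ) ∣ c) {τ : ℂ}
    (hτ : 0 < τ.im) : F26 ((a * τ + b) / (c * τ + d)) ^ 12 = F26 τ ^ 12 := by
  have hη {N : ℤ} (hN : 0 < N) (hNc : N ∣ 26) :=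
    dedekindEta_mul_moebius_pow h hN (hNc.trans hc) hτ
  have h1 := dedekindEta_moebius_pow h hτ
  have h2 := hη (N := 2) (by norm_num) (by norm_num)
  have h13 := hη (N := 13) (by norm_num) (by norm_num)
  have h26 := hη (N := 26) (by norm_num) (by norm_num)
  have hne := moebius_denom_ne_zero h hτ
  push_cast at h2 h13 h26
  simp only [F26, div_pow, mul_pow, ← pow_mul, Nat.reduceMul, h1, h2, h13, h26]
  have hη1 := dedekindEta_ne_zero hτ
  have hη13 := dedekindEta_ne_zero (im_ofNat_mul_pos (n := 13) hτ)
  field_simp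

/-- The span of `F(τ) = η(2τ)²η(26τ)²/(η(τ)²η(13τ)²)` is preserved, up to a twelfth
root of unity, by every element of `Γ₀(26)`. -/
theorem gamma0_26_invariance_26ABC (a b c d : ℤ) (h : a * d - b * c = 1) (hc : (26 : ℤ) ∣ c) :
    ∃ w : ℂ, w ^ 12 = 1 ∧ ∀ τ : ℂ, 0 < τ.im →
      F26 (((a : ℂ) * τ + (b : ℂ)) / ((c : ℂ) * τ + (d : ℂ))) = w * F26 τ := by
  have hfinite : {w : ℂ | w ^ 12 = 1}.Finite := by
    refine (Polynomial.nthRootsFinset 12 (1 : ℂ)).finite_toSet.subset fun w hw ↦ ?_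
    exact (Polynomial.mem_nthRootsFinset (by norm_num) _).mpr hw
  have hcont : ContinuousOn
      (fun τ : ℂ ↦ F26 (((a : ℂ) * τ + b) / (c * τ + d)) / F26 τ) upperHalfPlaneSet := by
    intro τ hτ
    refine (ContinuousAt.div ?_ (continuousAt_F26 hτ) (F26_ne_zero hτ)).continuousWithinAt
    refine (continuousAt_F26 (im_moebius_pos h hτ)).comp
      (f := fun z : ℂ ↦ ((a : ℂ) * z + b) / (c * z + d)) ?_
    exact ContinuousAt.div (by fun_prop) (by fun_prop) (moebius_denom_ne_zero h hτ)
  obtain ⟨w, hw, hconst⟩ := (convex_halfSpace_im_gt 0).isPreconnected.eqOn_const_of_mapsTo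
    hfinite.isDiscrete hcont
    (fun τ hτ ↦ by
      rw [Set.mem_ofPred_eq, div_pow, F26_moebius_pow h hc hτ,
        div_self (pow_ne_zero _ (F26_ne_zero hτ))])
    ⟨1, one_pow _⟩
  exact ⟨w, hw, fun τ hτ ↦ (div_eq_iff (F26_ne_zero hτ)).mp (hconst hτ)⟩
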